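/- Every stable interval translation map T ∈ ITM(r) is of finite type. -/

import Mathlib

open Set Filter
open scoped Classical

/-- An interval translation map on `r ≥ 2` intervals: discontinuity points
`0 = β₀ < β₁ < ⋯ < β_{r−1} < β_r = 1` and translation parameters
`γ_i ∈ [−β_{i−1}, 1−β_i]`, acting by `T(x) = x + γ_i` for `x ∈ [β_{i−1}, β_i)`. -/
structure ITM (r : ℕ) : Type where
  beta : Fin (r + 1) → ℝ
  gamma : Fin r → ℝ
  two_le_r : 2 ≤ r
  beta_zero : beta 0 = 0
  beta_last : beta (Fin.last r) = 1
  beta_mono : StrictMono beta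
  gamma_mem : ∀ i : Fin r, gamma i ∈ Set.Icc (-(beta i.castSucc)) (1 - beta i.succ)

namespace ITM

variable {r : ℕ}

/-- The unit interval `I = [0,1)`. -/
def unitIco : Set ℝ := Set.Ico 0 1

/-- Index of the partition interval `I_i = [β_{i−1}, β_i)` containing `x`. -/
noncomputable def idx (T : ITM r) (x : ℝ) : Fin r :=
  if h : ∃ i : Fin r, x ∈ Set.Ico (T.beta i.castSucc) (T.beta i.succ) then h.choose
  else ⟨0, by have := T.two_le_r; omega⟩

/-- The interval translation map itself (right-continuous version), extended by the
identity off `[0,1)`. -/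
noncomputable def f (T : ITM r) (x : ℝ) : ℝ :=
  if x ∈ unitIco then x + T.gamma (T.idx x) else x

/-- Index of the partition interval `(β_{i−1}, β_i]` containing `x` (left-limit version). -/
noncomputable def idxm (T : ITM r) (x : ℝ) : Fin r :=
  if h : ∃ i : Fin r, x ∈ Set.Ioc (T.beta i.castSucc) (T.beta i.succ) then h.choose
  else ⟨0, by have := T.two_le_r; omega⟩

/-- The left-limit version of `T`: `T(x⁻) = lim_{t↑x} T(t)`. -/
noncomputable def fm (T : ITM r) (x : ℝ) : ℝ :=
  if x ∈ Set.Ioc (0 : ℝ) 1 then x + T.gamma (T.idxm x) else x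

/-- Dynamics on signed points: `(x, true)` represents `x⁺` and `(x, false)` represents `x⁻`. -/
noncomputable def sf (T : ITM r) (p : ℝ × Bool) : ℝ × Bool :=
  if p.2 then (T.f p.1, true) else (T.fm p.1, false)

/-- `X_n = T^n(I)`. -/
noncomputable def Xn (T : ITM r) (n : ℕ) : Set ℝ := (T.f)^[n] '' unitIco

/-- The attractor `X = ⋂_{n≥0} X_n`. -/
noncomputable def X (T : ITM r) : Set ℝ := ⋂ n : ℕ, T.Xn n

/-- The closure `X̄` of the attractor in `[0,1]` (equivalently, in `ℝ`). -/
noncomputable def Xbar (T : ITM r) : Set ℝ := closure T.X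

/-- `T` is of finite type if `X_{n+1} = X_n` for some `n`. -/
def FiniteType (T : ITM r) : Prop := ∃ n : ℕ, T.Xn (n + 1) = T.Xn n

/-- The set of (unsigned) discontinuities `{β₁, …, β_{r−1}}` of `T`. -/
def critSet (T : ITM r) : Set ℝ :=
  {b : ℝ | ∃ i : Fin (r + 1), i ≠ 0 ∧ i ≠ Fin.last r ∧ b = T.beta i}

/-- The signed critical set `𝒞 = {β₁⁻, β₁⁺, …, β_{r−1}⁻, β_{r−1}⁺}`. -/
def signedCrit (T : ITM r) : Set (ℝ × Bool) := {p : ℝ × Bool | p.1 ∈ T.critSet}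

/-- `x` lands on a discontinuity of `T`: some forward iterate (`k ≥ 0`) is a discontinuity. -/
def landsOnCrit (T : ITM r) (x : ℝ) : Prop := ∃ k : ℕ, (T.f)^[k] x ∈ T.critSet

/-- The first return time of `x` to the set `J` (by convention `0` if `x` never returns). -/
noncomputable def returnTime (T : ITM r) (J : Set ℝ) (x : ℝ) : ℕ :=
  sInf {k : ℕ | 0 < k ∧ (T.f)^[k] x ∈ J}

/-- The first return map `R_J`. -/
noncomputable def returnMap (T : ITM r) (J : Set ℝ) (x : ℝ) : ℝ :=
  (T.f)^[T.returnTime J x] x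

/-- `J` is an interval component of `X`: a connected component of `X` which is a
(nondegenerate, half-open) interval `[x,y)`. -/
def IsIntervalComponent (T : ITM r) (J : Set ℝ) : Prop :=
  (∃ z ∈ T.X, J = connectedComponentIn T.X z) ∧ ∃ x y : ℝ, x < y ∧ J = Set.Ico x y

/-- A dynamically trivial interval component: no point of its interior lands on a
discontinuity and the first return map is the identity. -/
def DynTrivial (T : ITM r) (J : Set ℝ) : Prop :=
  T.IsIntervalComponent J ∧ (∀ a ∈ interior J, ¬ T.landsOnCrit a) ∧
    ∀ z ∈ J, T.returnMap J z = z

/-- Signed membership in `[x,y)`: `+`-points of `[x,y)` and `−`-points of `(x,y]`. -/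
def smem (x y : ℝ) (p : ℝ × Bool) : Prop :=
  if p.2 then p.1 ∈ Set.Ico x y else p.1 ∈ Set.Ioc x y

/-- First return time of a signed point to the interval `[x,y)`. -/
noncomputable def sReturnTime (T : ITM r) (x y : ℝ) (p : ℝ × Bool) : ℕ :=
  sInf {k : ℕ | 0 < k ∧ smem x y ((T.sf)^[k] p)}

/-- Condition A1: for every interval component `J` of `X` and every `a ∈ J`, the orbit of
`a` up to (and not including) its return time to `J` contains at most one critical point. -/
def A1 (T : ITM r) : Prop :=
  ∀ J : Set ℝ, T.IsIntervalComponent J → ∀ a ∈ J,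
    Set.Subsingleton {c : ℝ | c ∈ T.critSet ∧ ∃ k < T.returnTime J a, (T.f)^[k] a = c}

/-- Condition A2: for every dynamically non-trivial interval component `[x,y)`, neither
(signed) boundary point `x⁺`, `y⁻` lands on a discontinuity up to (and not including)
its return time. -/
def A2 (T : ITM r) : Prop :=
  ∀ x y : ℝ, T.IsIntervalComponent (Set.Ico x y) → ¬ T.DynTrivial (Set.Ico x y) →
    (∀ k < T.sReturnTime x y (x, true), (T.sf)^[k] (x, true) ∉ T.signedCrit) ∧
    (∀ k < T.sReturnTime x y (y, false), (T.sf)^[k] (y, false) ∉ T.signedCrit)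

/-- `c'` is a ghost preimage of `c`: a signed discontinuity of opposite sign whose
(signed) orbit lands on the point of `c` with the sign of `c'`. -/
def GhostPre (T : ITM r) (c' c : ℝ × Bool) : Prop :=
  c ∈ T.signedCrit ∧ c' ∈ T.signedCrit ∧ c'.2 = !c.2 ∧
    ∃ k : ℕ, (T.sf)^[k] c' = (c.1, c'.2)

/-- A descending chain of length `n` in a ghost tree: `c (i+1)` is a ghost preimage of `c i`. -/
def GhostChain (T : ITM r) (n : ℕ) (c : ℕ → ℝ × Bool) : Prop :=
  ∀ i < n, T.GhostPre (c (i + 1)) (c i)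

/-- `b` occurs as a vertex of positive level in its own ghost tree `GT(b)`. -/
def SelfGhost (T : ITM r) (b : ℝ × Bool) : Prop :=
  ∃ n : ℕ, 0 < n ∧ ∃ c : ℕ → ℝ × Bool, c 0 = b ∧ c n = b ∧ T.GhostChain n c

/-- Condition A3: no discontinuity `β ∉ X` occurs in its own ghost tree at positive level. -/
def A3 (T : ITM r) : Prop := ∀ b ∈ T.signedCrit, b.1 ∉ T.X → ¬ T.SelfGhost b

/-- The Absence of Critical Connections condition. -/
def ACC (T : ITM r) : Prop := T.A1 ∧ T.A2 ∧ T.A3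

/-- The Matching condition: for every dynamically non-trivial interval component `J` of
`X`, exactly one point of the interior of `J` lands on a critical point before returning. -/
def Matching (T : ITM r) : Prop :=
  ∀ J : Set ℝ, T.IsIntervalComponent J → ¬ T.DynTrivial J →
    ∃! a : ℝ, a ∈ interior J ∧ ∃ k < T.returnTime J a, (T.f)^[k] a ∈ T.critSet

/-- Distance between two maps in the parameter space `ITM(r)`. -/
noncomputable def pdist (T S : ITM r) : ℝ := dist T.gamma S.gamma ⊔ dist T.beta S.beta

/-- The number of discontinuities of `T` contained in `I ∖ X̄`. -/
noncomputable def ncritOutside (T : ITM r) : ℕ := (T.critSet \ T.Xbar).ncard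

/-- `T` is stable: on some neighbourhood `𝒰` of `T` in `ITM(r)`, the assignment
`T̃ ↦ X̄(T̃)` is continuous in the Hausdorff topology, all `X̄(T̃)` are homeomorphic to
`X̄(T)`, and the number of discontinuities in `I ∖ X̄(T̃)` is constant. -/
def Stable (T : ITM r) : Prop :=
  ∃ δ : ℝ, 0 < δ ∧
    (∀ S : ITM r, pdist S T < δ → Nonempty (S.Xbar ≃ₜ T.Xbar)) ∧
    (∀ S : ITM r, pdist S T < δ → ∀ ε : ℝ, 0 < ε → ∃ η : ℝ, 0 < η ∧
      ∀ S' : ITM r, pdist S' T < δ → pdist S' S < η →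
        Metric.hausdorffDist S'.Xbar S.Xbar < ε) ∧
    (∀ S : ITM r, pdist S T < δ → S.ncritOutside = T.ncritOutside)

/-- The non-wandering set `Ω(T)` (neighbourhoods taken inside `I = [0,1)`). -/
def nonwandering (T : ITM r) : Set ℝ :=
  {x : ℝ | x ∈ unitIco ∧ ∀ U : Set ℝ, IsOpen U → x ∈ U →
    ∃ n : ℕ, 0 < n ∧ ((T.f)^[n] '' (U ∩ unitIco) ∩ (U ∩ unitIco)).Nonempty}

/-- `S` and `S'` are topologically conjugate on the sets `A`, `B`: there is a
homeomorphism `h : A → B` with `h ∘ S = S' ∘ h` on `A`. -/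
def TopConjOn (S S' : ITM r) (A B : Set ℝ) : Prop :=
  ∃ h g : ℝ → ℝ, Set.BijOn h A B ∧ ContinuousOn h A ∧ Set.InvOn g h A B ∧
    ContinuousOn g B ∧ ∀ x ∈ A, h (S.f x) = S'.f (h x)

/-- No point of the interior of `K` lands on a discontinuity before its return time to `J`. -/
def NoCritBeforeReturnOn (T : ITM r) (J K : Set ℝ) : Prop :=
  ∀ z ∈ interior K, ∀ k < T.returnTime J z, (T.f)^[k] z ∉ T.critSet

/-- `K` is a continuity interval of the first return map `R_J`: a maximal half-open
subinterval of `J` no interior point of which lands on a discontinuity before returning. -/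
def IsContinuityInterval (T : ITM r) (J K : Set ℝ) : Prop :=
  (∃ u v : ℝ, u < v ∧ K = Set.Ico u v) ∧ K ⊆ J ∧ T.NoCritBeforeReturnOn J K ∧
    ∀ K' : Set ℝ, (∃ u v : ℝ, u < v ∧ K' = Set.Ico u v) → K ⊆ K' → K' ⊆ J →
      T.NoCritBeforeReturnOn J K' → K' = K

/-- The itinerary symbol of a signed point. -/
noncomputable def sidx (T : ITM r) (p : ℝ × Bool) : Fin r :=
  if p.2 then T.idx p.1 else T.idxm p.1

/-- The forward orbit of `x` accumulates on `c` from the left. -/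
def accumFromLeft (T : ITM r) (x c : ℝ) : Prop :=
  ∃ n : ℕ → ℕ, StrictMono n ∧ StrictMono (fun k => (T.f)^[n k] x) ∧
    Filter.Tendsto (fun k => (T.f)^[n k] x) Filter.atTop (nhds c)

/-- The forward orbit of `x` accumulates on `c` from the right. -/
def accumFromRight (T : ITM r) (x c : ℝ) : Prop :=
  ∃ n : ℕ → ℕ, StrictMono n ∧ StrictAnti (fun k => (T.f)^[n k] x) ∧
    Filter.Tendsto (fun k => (T.f)^[n k] x) Filter.atTop (nhds c)

end ITM

open Topology

/-- Membership in `A` is eventually constant along `l`. -/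
def EventuallyDecided (l : Filter ℝ) (A : Set ℝ) : Prop :=
  (∀ᶠ y in l, y ∈ A) ∨ ∀ᶠ y in l, y ∉ A

namespace EventuallyDecided

variable {l l' : Filter ℝ} {A B : Set ℝ}

lemma compl (h : EventuallyDecided l A) : EventuallyDecided l Aᶜ := by
  rcases h with h | h
  · exact Or.inr (h.mono fun y hy hn => hn hy)
  · exact Or.inl h

lemma inter (hA : EventuallyDecided l A) (hB : EventuallyDecided l B) :
    EventuallyDecided l (A ∩ B) := by
  rcases hA with hA | hA
  · rcases hB with hB | hB
    · exact Or.inl (hA.and hB)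
    · exact Or.inr (hB.mono fun y hy h => hy h.2)
  · exact Or.inr (hA.mono fun y hy h => hy h.1)

lemma biUnion {ι : Type*} {s : Set ι} (hs : s.Finite) {A : ι → Set ℝ}
    (h : ∀ i ∈ s, EventuallyDecided l (A i)) : EventuallyDecided l (⋃ i ∈ s, A i) := by
  by_cases hex : ∃ i ∈ s, ∀ᶠ y in l, y ∈ A i
  · obtain ⟨i, hi, hy⟩ := hex
    exact Or.inl (hy.mono fun y hy => mem_biUnion hi hy)
  · refine Or.inr ?_
    have : ∀ᶠ y in l, ∀ i ∈ s, y ∉ A i :=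
      (eventually_all_finite hs).2 fun i hi => (h i hi).resolve_left fun hi' => hex ⟨i, hi, hi'⟩
    filter_upwards [this] with y hy
    simpa using hy

lemma preimage {g : ℝ → ℝ} (h : EventuallyDecided l' A) (hg : Tendsto g l l') :
    EventuallyDecided l (g ⁻¹' A) :=
  h.imp (fun h => hg.eventually h) fun h => hg.eventually h

lemma eventually_of_frequently (h : EventuallyDecided l A) (hf : ∃ᶠ y in l, y ∈ A) :
    ∀ᶠ y in l, y ∈ A :=
  h.resolve_right hf

end EventuallyDecided

/-- Sets that look like finite unions of half-open intervals `[a, b)` near every point. -/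
def IsTame (A : Set ℝ) : Prop :=
  ∀ x, EventuallyDecided (𝓝[≥] x) A ∧ EventuallyDecided (𝓝[<] x) A

lemma isTame_Ico (a b : ℝ) : IsTame (Ico a b) := by
  intro x
  constructor
  · rcases lt_or_ge x a with h | h
    · exact Or.inr (mem_nhdsWithin_of_mem_nhds
        (by filter_upwards [Iio_mem_nhds h] with y hy hy' using absurd hy'.1 (not_le.2 hy)))
    · rcases lt_or_ge x b with hb | hb
      · left
        filter_upwards [mem_nhdsWithin_of_mem_nhds (Iio_mem_nhds hb), self_mem_nhdsWithin]
          with y hy hy' using ⟨h.trans hy', hy⟩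
      · right
        filter_upwards [self_mem_nhdsWithin] with y hy hy'
        exact absurd hy'.2 (not_lt.2 (hb.trans hy))
  · rcases le_or_gt x a with h | h
    · right
      filter_upwards [self_mem_nhdsWithin] with y hy hy'
      exact absurd hy'.1 (not_le.2 (lt_of_lt_of_le hy h))
    · rcases le_or_gt x b with hb | hb
      · left
        filter_upwards [mem_nhdsWithin_of_mem_nhds (Ioi_mem_nhds h), self_mem_nhdsWithin]
          with y hy hy' using ⟨le_of_lt hy, lt_of_lt_of_le hy' hb⟩
      · exact Or.inr (mem_nhdsWithin_of_mem_nhds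
          (by
            filter_upwards [Ioi_mem_nhds hb] with y hy hy'
            exact absurd hy'.2 (not_lt.2 (le_of_lt hy))))

lemma tendsto_add_const_nhdsGE (x c : ℝ) : Tendsto (fun y => y + c) (𝓝[≥] x) (𝓝[≥] (x + c)) :=
  tendsto_nhdsWithin_iff.2 ⟨((continuous_id.add continuous_const).tendsto' x (x + c) rfl).mono_left
    nhdsWithin_le_nhds, by filter_upwards [self_mem_nhdsWithin] with y hy; simpa using hy⟩

lemma tendsto_add_const_nhdsLT (x c : ℝ) : Tendsto (fun y => y + c) (𝓝[<] x) (𝓝[<] (x + c)) :=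
  tendsto_nhdsWithin_iff.2 ⟨((continuous_id.add continuous_const).tendsto' x (x + c) rfl).mono_left
    nhdsWithin_le_nhds, by filter_upwards [self_mem_nhdsWithin] with y hy; simpa using hy⟩

/-- An order-connected set is eventually decided on either side of a point. -/
lemma Set.OrdConnected.eventuallyDecided_nhdsGT {S : Set ℝ} (hS : S.OrdConnected) (x : ℝ) :
    EventuallyDecided (𝓝[>] x) S := by
  by_contra h
  obtain ⟨h1, h2⟩ := not_or.1 h
  have h2 : ∃ᶠ y in 𝓝[>] x, y ∈ S := h2
  obtain ⟨a, haS, ha⟩ := (h2.and_eventually self_mem_nhdsWithin).exists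
  apply h1
  filter_upwards [Ioo_mem_nhdsGT ha] with y hy
  obtain ⟨b, hbS, hb⟩ := (h2.and_eventually (Ioo_mem_nhdsGT hy.1)).exists
  exact hS.out hbS haS ⟨hb.2.le, hy.2.le⟩

lemma Set.OrdConnected.eventuallyDecided_nhdsLT {S : Set ℝ} (hS : S.OrdConnected) (x : ℝ) :
    EventuallyDecided (𝓝[<] x) S := by
  by_contra h
  obtain ⟨h1, h2⟩ := not_or.1 h
  have h2 : ∃ᶠ y in 𝓝[<] x, y ∈ S := h2
  obtain ⟨a, haS, ha⟩ := (h2.and_eventually self_mem_nhdsWithin).exists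
  apply h1
  filter_upwards [Ioo_mem_nhdsLT ha] with y hy
  obtain ⟨b, hbS, hb⟩ := (h2.and_eventually (Ioo_mem_nhdsLT hy.2)).exists
  exact hS.out haS hbS ⟨hy.1.le, hb.1.le⟩

/-- A right-continuous piecewise translation with finitely many translation lengths. -/
structure IsPiecewiseTranslation (f : ℝ → ℝ) : Prop where
  right : ∀ x, ∀ᶠ y in 𝓝[≥] x, f y = y + (f x - x)
  left : ∀ x, ∃ c, ∀ᶠ y in 𝓝[<] x, f y = y + c
  finite : (range fun y => f y - y).Finite

lemma exists_forall_of_finite_of_antitone {ι : Type*} {s : Set ι} (hs : s.Finite)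
    {P : ℕ → ι → Prop} (hP : ∀ m n, m ≤ n → ∀ i, P n i → P m i) (h : ∀ n, ∃ i ∈ s, P n i) :
    ∃ i ∈ s, ∀ n, P n i := by
  by_contra! hcon
  choose! N hN using hcon
  obtain ⟨M, hM⟩ := (hs.image N).bddAbove
  obtain ⟨i, hi, hPi⟩ := h M
  exact hN i hi (hP _ _ (hM (mem_image_of_mem N hi)) i hPi)

lemma exists_backward_orbit {f : ℝ → ℝ} {S : Set ℝ} (hne : S.Nonempty) (hS : S ⊆ f '' S) :
    ∃ p : ℕ → ℝ, (∀ n, p n ∈ S) ∧ ∀ n, f (p (n + 1)) = p n := by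
  choose! g hg using hS
  obtain ⟨x, hx⟩ := hne
  have hmem : ∀ n, g^[n] x ∈ S := by
    intro n
    induction n with
    | zero => exact hx
    | succ n ih => rw [Function.iterate_succ_apply']; exact (hg ih).1
  exact ⟨fun n => g^[n] x, hmem, fun n => by
    dsimp only; rw [Function.iterate_succ_apply']; exact (hg (hmem n)).2⟩

lemma iterate_backward_orbit {f : ℝ → ℝ} {p : ℕ → ℝ} (hp : ∀ n, f (p (n + 1)) = p n) (n k : ℕ) :
    f^[k] (p (n + k)) = p n := by
  induction k with
  | zero => rfl
  | succ k ih => rw [Function.iterate_succ_apply, ← add_assoc, hp, ih]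

lemma mem_image_iff_exists_displacement {f : ℝ → ℝ} {A : Set ℝ} {y : ℝ} :
    y ∈ f '' A ↔ ∃ c ∈ range (fun y => f y - y), y - c ∈ A ∧ f (y - c) = y := by
  constructor
  · rintro ⟨x, hx, rfl⟩
    exact ⟨f x - x, ⟨x, rfl⟩, by simpa using hx, by simp⟩
  · rintro ⟨c, -, h, h'⟩
    exact ⟨_, h, h'⟩

lemma eventually_iterate_nhdsLT {f g : ℝ → ℝ}
    (hg : ∀ x, ∀ᶠ y in 𝓝[<] x, f y = y + (g x - x)) (k : ℕ) (x : ℝ) :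
    ∀ᶠ y in 𝓝[<] x, f^[k] y = y + (g^[k] x - x) := by
  induction k with
  | zero => simp
  | succ k ih =>
    have h := (tendsto_add_const_nhdsLT x (g^[k] x - x)).eventually (hg _)
    filter_upwards [ih, h] with y hy hy'
    rw [Function.iterate_succ_apply', Function.iterate_succ_apply', hy, hy']
    rw [add_sub_cancel]
    ring

namespace IsPiecewiseTranslation

variable {f : ℝ → ℝ}

lemma isTame_displacement (hf : IsPiecewiseTranslation f) (c : ℝ) : IsTame {z | f z = z + c} := by
  intro x
  constructor
  · by_cases h : f x - x = c
    · exact Or.inl (by filter_upwards [hf.right x] with y hy using by rw [← h]; exact hy)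
    · exact Or.inr (by
        filter_upwards [hf.right x] with y hy hy'
        exact h (by linarith [hy'.symm.trans hy]))
  · obtain ⟨d, hd⟩ := hf.left x
    by_cases h : d = c
    · exact Or.inl (by filter_upwards [hd] with y hy using by rw [← h]; exact hy)
    · exact Or.inr (by
        filter_upwards [hd] with y hy hy'
        exact h (by linarith [hy'.symm.trans hy]))

lemma isTame_image (hf : IsPiecewiseTranslation f) {A : Set ℝ} (hA : IsTame A) : IsTame (f '' A) := by
  have key : f '' A = ⋃ c ∈ range (fun y => f y - y),
      (fun y => y + -c) ⁻¹' (A ∩ {z | f z = z + c}) := by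
    ext y
    rw [mem_image_iff_exists_displacement]
    simp [sub_eq_add_neg]
  rw [key]
  intro x
  exact ⟨.biUnion hf.finite fun c _ => ((hA _).1.inter (hf.isTame_displacement c _).1).preimage
      (tendsto_add_const_nhdsGE x (-c)),
    .biUnion hf.finite fun c _ => ((hA _).2.inter (hf.isTame_displacement c _).2).preimage
      (tendsto_add_const_nhdsLT x (-c))⟩

lemma iterate_right (hf : IsPiecewiseTranslation f) (k : ℕ) (x : ℝ) :
    ∀ᶠ y in 𝓝[≥] x, f^[k] y = y + (f^[k] x - x) := by
  induction k with
  | zero => simp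
  | succ k ih =>
    have h := (tendsto_add_const_nhdsGE x (f^[k] x - x)).eventually (hf.right _)
    filter_upwards [ih, h] with y hy hy'
    rw [Function.iterate_succ_apply', Function.iterate_succ_apply', hy, hy']
    rw [add_sub_cancel]
    ring

end IsPiecewiseTranslation

/-- A continuous self-covering of a compact set of reals all of whose points are isolated from the
right has a periodic orbit. -/
lemma exists_periodic_of_right_isolated {E : Set ℝ} {g : ℝ → ℝ} (hE : IsCompact E)
    (hne : E.Nonempty) (hg : ContinuousOn g E) (hsurj : E ⊆ g '' E)
    (hiso : ∀ q ∈ E, ∀ᶠ y in 𝓝[>] q, y ∉ E) : ∃ p ∈ E, ∃ k, 0 < k ∧ g^[k] p = p := by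
  let 𝒮 : Set (Set ℝ) := {M | M ⊆ E ∧ IsClosed M ∧ M.Nonempty ∧ MapsTo g M M}
  have hclosure : ∀ S : Set ℝ, S ⊆ E → MapsTo g S S → MapsTo g (closure S) (closure S) :=
    fun S hSE hS => hS.closure_of_continuousOn (hg.mono (closure_minimal hSE hE.isClosed))
  have hne𝒮 : 𝒮.Nonempty := by
    obtain ⟨p, hpE, hp⟩ := exists_backward_orbit hne hsurj
    let A : ℕ → Set ℝ := fun N => closure (p '' Ici N)
    have hAE : ∀ N, A N ⊆ E := fun N => closure_minimal (by rintro _ ⟨n, -, rfl⟩; exact hpE n)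
      hE.isClosed
    have hAanti : ∀ N, A (N + 1) ⊆ A N := fun N =>
      closure_mono (image_mono (Ici_subset_Ici.2 N.le_succ))
    refine ⟨⋂ N, A N, (iInter_subset A 0).trans (hAE 0), isClosed_iInter fun N => isClosed_closure,
      IsCompact.nonempty_iInter_of_sequence_nonempty_isCompact_isClosed A hAanti
        (fun N => ⟨p N, subset_closure ⟨N, self_mem_Ici, rfl⟩⟩)
        (hE.of_isClosed_subset isClosed_closure (hAE 0)) fun N => isClosed_closure, ?_⟩
    intro a ha
    refine mem_iInter.2 fun N => ?_
    have : MapsTo g (p '' Ici (N + 1)) (p '' Ici N) := by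
      rintro _ ⟨n, hn, rfl⟩
      obtain ⟨m, rfl⟩ : ∃ m, n = m + 1 := ⟨n - 1, by have : N + 1 ≤ n := hn; omega⟩
      exact ⟨m, Nat.le_of_succ_le_succ hn, (hp m).symm⟩
    exact this.closure_of_continuousOn (hg.mono (hAE _)) (mem_iInter.1 ha (N + 1))
  obtain ⟨M, hM⟩ : ∃ M, Minimal (· ∈ 𝒮) M := by
    refine zorn_superset 𝒮 fun c hc hchain => ?_
    rcases c.eq_empty_or_nonempty with rfl | hcne
    · exact ⟨hne𝒮.some, hne𝒮.some_mem, by simp⟩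
    · refine ⟨⋂₀ c, ⟨?_, isClosed_sInter fun s hs => (hc hs).2.1, ?_, ?_⟩,
        fun s hs => sInter_subset_of_mem hs⟩
      · exact (sInter_subset_of_mem hcne.some_mem).trans (hc hcne.some_mem).1
      · have : Nonempty c := hcne.to_subtype
        exact IsCompact.nonempty_sInter_of_directed_nonempty_isCompact_isClosed
          (fun s hs t ht => (hchain.total hs ht).elim (fun h => ⟨s, hs, Subset.rfl, h⟩)
            fun h => ⟨t, ht, h, Subset.rfl⟩) (fun s hs => (hc hs).2.2.1)
          (fun s hs => hE.of_isClosed_subset (hc hs).2.1 (hc hs).1) fun s hs => (hc hs).2.1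
      · exact fun x hx s hs => (hc hs).2.2.2 (hx s hs)
  obtain ⟨hME, hMcl, hMne, hMg⟩ := hM.prop
  obtain ⟨m, hmM, hmin⟩ := (hE.of_isClosed_subset hMcl hME).exists_isLeast hMne
  have horb : ∀ k, g^[k] m ∈ M := fun k => hMg.iterate k hmM
  let S : Set ℝ := (fun k => g^[k] m) '' Ioi 0
  have hSM : S ⊆ M := by rintro _ ⟨k, -, rfl⟩; exact horb k
  have hcl : closure S ∈ 𝒮 := by
    refine ⟨closure_minimal (hSM.trans hME) hE.isClosed, isClosed_closure,
      ⟨_, subset_closure ⟨1, mem_Ioi.2 one_pos, rfl⟩⟩, hclosure S (hSM.trans hME) ?_⟩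
    rintro _ ⟨k, -, rfl⟩
    exact ⟨k + 1, Nat.succ_pos k, Function.iterate_succ_apply' _ _ _⟩
  have hmS : m ∈ closure S := hM.le_of_le hcl (closure_minimal hSM hMcl) hmM
  have hfreq : ∃ᶠ y in 𝓝 m, y ∈ S := mem_closure_iff_frequently.1 hmS
  have hright : ∀ᶠ y in 𝓝 m, y ∈ Ioi m → y ∉ E := eventually_nhdsWithin_iff.1 (hiso m (hME hmM))
  obtain ⟨y, hyS, hy⟩ := (hfreq.and_eventually hright).exists
  have hym : y = m := by
    rcases (hmin (hSM hyS)).eq_or_lt with h | h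
    · exact h.symm
    · exact absurd (hME (hSM hyS)) (hy h)
  obtain ⟨k, hk, hky⟩ := hyS
  exact ⟨m, hME hmM, k, hk, hky.trans hym⟩

/-- The image of `[0, 1)` under the `n`-th iterate of `f`. -/
def iterImage (f : ℝ → ℝ) (n : ℕ) : Set ℝ := f^[n] '' Ico 0 1

/-- The intersection of all iterated images of `[0, 1)`. -/
def attractor (f : ℝ → ℝ) : Set ℝ := ⋂ n, iterImage f n

section attractor

variable {f : ℝ → ℝ}

lemma iterImage_succ (f : ℝ → ℝ) (n : ℕ) : iterImage f (n + 1) = f '' iterImage f n := by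
  rw [iterImage, iterImage, Function.iterate_succ', image_comp]

lemma iterImage_antitone (hI : MapsTo f (Ico 0 1) (Ico 0 1)) : Antitone (iterImage f) := by
  refine antitone_nat_of_succ_le fun n => ?_
  rw [iterImage, Function.iterate_succ, image_comp]
  exact image_mono hI.image_subset

lemma attractor_subset (f : ℝ → ℝ) (n : ℕ) : attractor f ⊆ iterImage f n := iInter_subset _ n

lemma iterImage_zero (f : ℝ → ℝ) : iterImage f 0 = Ico 0 1 := image_id _

lemma image_attractor_subset (hI : MapsTo f (Ico 0 1) (Ico 0 1)) :
    f '' attractor f ⊆ attractor f := by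
  refine subset_iInter fun n => ?_
  refine (image_mono (attractor_subset f n)).trans ?_
  rw [← iterImage_succ]
  exact iterImage_antitone hI n.le_succ

lemma mem_attractor_of_periodic (hI : MapsTo f (Ico 0 1) (Ico 0 1)) {k : ℕ} (hk : 0 < k) {y : ℝ}
    (hy : y ∈ Ico (0 : ℝ) 1) (hfix : f^[k] y = y) : y ∈ attractor f := by
  refine mem_iInter.2 fun n => iterImage_antitone hI (Nat.le_mul_of_pos_left n hk) ⟨y, hy, ?_⟩
  rw [Function.iterate_mul]
  exact Function.iterate_fixed hfix n

namespace IsPiecewiseTranslation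

lemma isTame_iterImage (hf : IsPiecewiseTranslation f) (n : ℕ) : IsTame (iterImage f n) := by
  induction n with
  | zero => rw [iterImage_zero]; exact isTame_Ico 0 1
  | succ n ih => rw [iterImage_succ]; exact hf.isTame_image ih

lemma attractor_subset_image (hf : IsPiecewiseTranslation f)
    (hI : MapsTo f (Ico 0 1) (Ico 0 1)) : attractor f ⊆ f '' attractor f := by
  intro x hx
  obtain ⟨c, -, hc⟩ := exists_forall_of_finite_of_antitone hf.finite
    (P := fun n c => x - c ∈ iterImage f n ∧ f (x - c) = x)
    (fun m n hmn c h => ⟨iterImage_antitone hI hmn h.1, h.2⟩) fun n => by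
      have := attractor_subset f (n + 1) hx
      rwa [iterImage_succ, mem_image_iff_exists_displacement] at this
  exact ⟨x - c, mem_iInter.2 fun n => (hc n).1, (hc 0).2⟩

/-- A point with a punctured right neighbourhood in the closure of the attractor lies in the
attractor. -/
lemma mem_attractor_of_eventually_mem_closure (hf : IsPiecewiseTranslation f) {x : ℝ}
    (h : ∀ᶠ y in 𝓝[>] x, y ∈ closure (attractor f)) : x ∈ attractor f := by
  refine mem_iInter.2 fun n => ?_
  rcases (hf.isTame_iterImage n x).1 with hn | hn
  · exact hn.self_of_nhdsWithin self_mem_Ici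
  · exfalso
    obtain ⟨u, hu, hsub⟩ := (mem_nhdsGE_iff_exists_Ico_subset).1 hn
    obtain ⟨y, hy, hyu⟩ := (h.and (Ioo_mem_nhdsGT hu)).exists
    obtain ⟨z, hz, hzX⟩ := mem_closure_iff.1 hy _ isOpen_Ioo hyu
    exact hsub ⟨hz.1.le, hz.2⟩ (attractor_subset f n hzX)

lemma subset_attractor_of_isOpen (hf : IsPiecewiseTranslation f) {U : Set ℝ} (hU : IsOpen U)
    (h : U ⊆ closure (attractor f)) : U ⊆ attractor f := fun _ hx =>
  hf.mem_attractor_of_eventually_mem_closure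
    (mem_nhdsWithin_of_mem_nhds (mem_of_superset (hU.mem_nhds hx) h))

lemma eventuallyDecided_attractor_nhdsGT (hf : IsPiecewiseTranslation f) {x : ℝ}
    (h : EventuallyDecided (𝓝[>] x) (closure (attractor f))) :
    EventuallyDecided (𝓝[>] x) (attractor f) := by
  rcases h with h | h
  · obtain ⟨u, hu, hsub⟩ := mem_nhdsGT_iff_exists_Ioo_subset.1 h
    exact Or.inl (mem_of_superset (Ioo_mem_nhdsGT hu) (hf.subset_attractor_of_isOpen isOpen_Ioo hsub))
  · exact Or.inr (h.mono fun y hy hy' => hy (subset_closure hy'))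

lemma eventuallyDecided_attractor_nhdsLT (hf : IsPiecewiseTranslation f) {x : ℝ}
    (h : EventuallyDecided (𝓝[<] x) (closure (attractor f))) :
    EventuallyDecided (𝓝[<] x) (attractor f) := by
  rcases h with h | h
  · obtain ⟨u, hu, hsub⟩ := mem_nhdsLT_iff_exists_Ioo_subset.1 h
    exact Or.inl (mem_of_superset (Ioo_mem_nhdsLT hu) (hf.subset_attractor_of_isOpen isOpen_Ioo hsub))
  · exact Or.inr (h.mono fun y hy hy' => hy (subset_closure hy'))

/-- If the closure of the attractor is decided on both sides of every point, then every point of the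
attractor has a right neighbourhood inside the attractor. -/
lemma eventually_mem_attractor (hf : IsPiecewiseTranslation f) (hI : MapsTo f (Ico 0 1) (Ico 0 1))
    (hgt : ∀ x, EventuallyDecided (𝓝[>] x) (closure (attractor f)))
    (hlt : ∀ x, EventuallyDecided (𝓝[<] x) (closure (attractor f))) {x : ℝ}
    (hx : x ∈ attractor f) : ∀ᶠ y in 𝓝[>] x, y ∈ attractor f := by
  let F : Set ℝ := {x | x ∈ attractor f ∧ ¬ ∀ᶠ y in 𝓝[>] x, y ∈ attractor f}
  have hgt' := fun x => hf.eventuallyDecided_attractor_nhdsGT (hgt x)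
  have hlt' := fun x => hf.eventuallyDecided_attractor_nhdsLT (hlt x)
  have hopen : ∀ U, IsOpen U → U ⊆ attractor f → ∀ y ∈ U, y ∉ F := fun U hU hUX y hy hyF =>
    hyF.2 (mem_nhdsWithin_of_mem_nhds (mem_of_superset (hU.mem_nhds hy) hUX))
  have hfin : F.Finite := by
    by_contra hinf
    obtain ⟨z, -, hz⟩ := Set.Infinite.exists_accPt_of_subset_isCompact hinf
      (isCompact_Icc (a := (0 : ℝ)) (b := 1)) fun y hy =>
        Ico_subset_Icc_self (iterImage_zero f ▸ attractor_subset f 0 hy.1)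
    rw [accPt_iff_frequently_nhdsNE, ← nhdsLT_sup_nhdsGT, frequently_sup] at hz
    rcases hz with hz | hz
    · obtain ⟨u, hu, hsub⟩ := mem_nhdsLT_iff_exists_Ioo_subset.1
        ((hlt' z).eventually_of_frequently (hz.mono fun y hy => hy.1))
      obtain ⟨y, hy, hyu⟩ := (hz.and_eventually (Ioo_mem_nhdsLT hu)).exists
      exact hopen _ isOpen_Ioo hsub y hyu hy
    · obtain ⟨u, hu, hsub⟩ := mem_nhdsGT_iff_exists_Ioo_subset.1
        ((hgt' z).eventually_of_frequently (hz.mono fun y hy => hy.1))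
      obtain ⟨y, hy, hyu⟩ := (hz.and_eventually (Ioo_mem_nhdsGT hu)).exists
      exact hopen _ isOpen_Ioo hsub y hyu hy
  by_contra hxF
  have hFimg : F ⊆ f '' F := by
    intro x hx
    obtain ⟨p, hp, rfl⟩ := hf.attractor_subset_image hI hx.1
    refine ⟨p, ⟨hp, fun hev => hx.2 ?_⟩, rfl⟩
    have hback : Tendsto (fun y => y + (p - f p)) (𝓝[>] (f p)) (𝓝[>] p) := by
      refine tendsto_nhdsWithin_iff.2 ⟨((continuous_id.add continuous_const).tendsto' _ _
        (by simp)).mono_left nhdsWithin_le_nhds, ?_⟩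
      filter_upwards [self_mem_nhdsWithin] with y hy
      have : f p < y := hy
      exact mem_Ioi.2 (by linarith)
    have hr := (hf.right p).filter_mono (nhdsWithin_mono p Ioi_subset_Ici_self)
    filter_upwards [hback.eventually hev, hback.eventually hr] with y hy hy'
    exact image_attractor_subset hI ⟨_, hy, by rw [hy']; ring⟩
  obtain ⟨p, hpF, hp⟩ := exists_backward_orbit (S := F) ⟨x, hx, hxF⟩ hFimg
  have : Finite F := hfin.to_subtype
  obtain ⟨i, j, hij, heq⟩ := Finite.exists_ne_map_eq_of_infinite fun n => (⟨p n, hpF n⟩ : F)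
  wlog hlt : i < j generalizing i j
  · exact this j i hij.symm heq.symm (lt_of_le_of_ne (not_lt.1 hlt) hij.symm)
  have heq : p i = p j := congrArg Subtype.val heq
  obtain ⟨k, rfl⟩ := Nat.exists_eq_add_of_lt hlt
  have hper : f^[k + 1] (p i) = p i := by
    conv_lhs => rw [heq]
    exact iterate_backward_orbit hp i (k + 1)
  refine (hpF i).2 ?_
  have hpI : p i ∈ Ico (0 : ℝ) 1 := iterImage_zero f ▸ attractor_subset f 0 (hpF i).1
  filter_upwards [(hf.iterate_right (k + 1) (p i)).filter_mono
    (nhdsWithin_mono _ Ioi_subset_Ici_self), Ioo_mem_nhdsGT hpI.2] with y hy hyI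
  rw [hper, sub_self, add_zero] at hy
  exact mem_attractor_of_periodic hI k.succ_pos ⟨hpI.1.trans hyI.1.le, hyI.2⟩ hy

lemma isTame_attractor (hf : IsPiecewiseTranslation f) (hI : MapsTo f (Ico 0 1) (Ico 0 1))
    (hgt : ∀ x, EventuallyDecided (𝓝[>] x) (closure (attractor f)))
    (hlt : ∀ x, EventuallyDecided (𝓝[<] x) (closure (attractor f))) : IsTame (attractor f) := by
  refine fun x => ⟨?_, hf.eventuallyDecided_attractor_nhdsLT (hlt x)⟩
  have hIci : ∀ p : ℝ → Prop, p x → (∀ᶠ y in 𝓝[>] x, p y) → ∀ᶠ y in 𝓝[≥] x, p y := by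
    intro p hx h
    rw [← nhdsGT_sup_nhdsWithin_singleton, nhdsWithin_singleton]
    exact eventually_sup.2 ⟨h, hx⟩
  by_cases hx : x ∈ attractor f
  · exact Or.inl (hIci _ hx (hf.eventually_mem_attractor hI hgt hlt hx))
  · refine Or.inr (hIci _ hx ((hf.eventuallyDecided_attractor_nhdsGT (hgt x)).resolve_left
      fun h => hx (hf.mem_attractor_of_eventually_mem_closure (h.mono fun y hy => subset_closure hy))))

/-- If the attractor is tame, the iterated images stabilise. -/
lemma exists_iterImage_eq_attractor (hf : IsPiecewiseTranslation f)
    (hI : MapsTo f (Ico 0 1) (Ico 0 1)) (htame : IsTame (attractor f)) :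
    ∃ n, iterImage f n = attractor f := by
  by_contra! hne
  let Z : ℕ → Set ℝ := fun n => iterImage f n \ attractor f
  have hZne : ∀ n, (Z n).Nonempty := fun n => by
    by_contra h
    exact hne n ((sdiff_eq_empty.1 (not_nonempty_iff_eq_empty.1 h)).antisymm (attractor_subset f n))
  have hZanti : Antitone Z := fun m n h => sdiff_subset_sdiff_left (iterImage_antitone hI h)
  have hZtame : ∀ n, IsTame (Z n) := fun n x =>
    ⟨(hf.isTame_iterImage n x).1.inter (htame x).1.compl,
      (hf.isTame_iterImage n x).2.inter (htame x).2.compl⟩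
  have hZimg : ∀ n, Z (n + 1) ⊆ f '' Z n := by
    rintro n y ⟨hy, hyX⟩
    rw [iterImage_succ] at hy
    obtain ⟨x, hx, rfl⟩ := hy
    exact ⟨x, ⟨hx, fun hxX => hyX (image_attractor_subset hI ⟨x, hxX, rfl⟩)⟩, rfl⟩
  have hZI : ∀ n, Z n ⊆ Ico 0 1 := fun n =>
    (hZanti n.zero_le).trans (sdiff_subset.trans (iterImage_zero f).subset)
  let E : Set ℝ := ⋂ n, closure (Z n)
  have hEcomp : ∀ n, IsCompact (closure (Z n)) := fun n =>
    (Metric.isBounded_Ico (0 : ℝ) 1).subset (hZI n) |>.isCompact_closure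
  have hE : IsCompact E := (hEcomp 0).of_isClosed_subset
    (isClosed_iInter fun n => isClosed_closure) (iInter_subset _ 0)
  have hEne : E.Nonempty := IsCompact.nonempty_iInter_of_sequence_nonempty_isCompact_isClosed _
    (fun n => closure_mono (hZanti n.le_succ)) (fun n => (hZne n).closure) (hEcomp 0)
    fun n => isClosed_closure
  have hright : ∀ q, ∃ N, ∀ᶠ y in 𝓝[≥] q, y ∉ Z N := by
    intro q
    by_contra! hq
    have hq' : ∀ n, q ∈ Z n := fun n =>
      ((hZtame n q).1.resolve_right (hq n)).self_of_nhdsWithin self_mem_Ici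
    exact (hq' 0).2 (mem_iInter.2 fun n => (hq' n).1)
  have hleft : ∀ q ∈ E, ∀ n, ∀ᶠ y in 𝓝[<] q, y ∈ Z n := by
    intro q hq n
    obtain ⟨N, hN⟩ := hright q
    have hfreq := mem_closure_iff_frequently.1 (mem_iInter.1 hq (max N n))
    rw [← nhdsLT_sup_nhdsGE, frequently_sup] at hfreq
    rcases hfreq with h | h
    · exact ((hZtame _ q).2.eventually_of_frequently h).mono fun y hy =>
        hZanti (le_max_right N n) hy
    · exact absurd (hN.mono fun y hy hy' => hy (hZanti (le_max_left N n) hy')) h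
  have hiso : ∀ q ∈ E, ∀ᶠ y in 𝓝[>] q, y ∉ E := by
    intro q _
    obtain ⟨N, hN⟩ := hright q
    obtain ⟨u, hu, hsub⟩ := mem_nhdsGE_iff_exists_Ico_subset.1 hN
    filter_upwards [Ioo_mem_nhdsGT hu] with y hy hyE
    obtain ⟨z, hz, hzZ⟩ := mem_closure_iff.1 (mem_iInter.1 hyE N) _ isOpen_Ioo hy
    exact hsub ⟨hz.1.le, hz.2⟩ hzZ
  choose c hc using hf.left
  let g : ℝ → ℝ := fun x => x + c x
  have hg : ∀ x, ∀ᶠ y in 𝓝[<] x, f y = y + (g x - x) := fun x => by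
    simpa [g] using hc x
  have hc_eq : ∀ x d, (∃ᶠ y in 𝓝[<] x, f y = y + d) → c x = d := by
    intro x d h
    obtain ⟨y, hy, hy'⟩ := (h.and_eventually (hc x)).exists
    linarith [hy.symm.trans hy']
  have hgcont : ContinuousOn g E := by
    intro q hq
    have hloc : ∀ᶠ y in 𝓝[E] q, g y = y + c q := by
      obtain ⟨u, hu, hsub⟩ := mem_nhdsLT_iff_exists_Ioo_subset.1 (hc q)
      have h1 : ∀ᶠ y in 𝓝[E] q, y ∈ Ioi u := mem_nhdsWithin_of_mem_nhds (Ioi_mem_nhds hu)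
      have h2 : ∀ᶠ y in 𝓝[E] q, y ∈ Ioi q → y ∉ E :=
        mem_nhdsWithin_of_mem_nhds (eventually_nhdsWithin_iff.1 (hiso q hq))
      filter_upwards [h1, h2, self_mem_nhdsWithin] with y hyu hyq hyE
      have hle : y ≤ q := not_lt.1 fun h => hyq h hyE
      refine congrArg (y + ·) (hc_eq y (c q) (Eventually.frequently ?_))
      filter_upwards [Ioo_mem_nhdsLT hyu] with z hz using hsub ⟨hz.1, hz.2.trans_le hle⟩
    refine ContinuousWithinAt.congr_of_eventuallyEq
      ((continuous_id.add continuous_const).continuousWithinAt) hloc rfl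
  have hsurj : E ⊆ g '' E := by
    intro q hq
    obtain ⟨d, -, hd⟩ := exists_forall_of_finite_of_antitone hf.finite
      (P := fun n d => ∃ᶠ y in 𝓝[<] q, y - d ∈ Z n ∧ f (y - d) = y)
      (fun m n hmn d h => h.mono fun y hy => ⟨hZanti hmn hy.1, hy.2⟩) fun n => by
        by_contra! hno
        have hall : ∀ᶠ y in 𝓝[<] q, ∀ d ∈ range (fun y => f y - y),
            ¬ (y - d ∈ Z n ∧ f (y - d) = y) :=
          (eventually_all_finite hf.finite).2 fun d hd => (hno d hd).mono fun y hy h => hy h.1 h.2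
        obtain ⟨y, hy, hyZ⟩ := (hall.and (hleft q hq (n + 1))).exists
        obtain ⟨d, hd, hyd⟩ := mem_image_iff_exists_displacement.1 (hZimg n hyZ)
        exact hy d hd hyd
    have htend : Tendsto (fun y => y + -d) (𝓝[<] q) (𝓝[<] (q + -d)) :=
      tendsto_add_const_nhdsLT q (-d)
    have hfr : ∀ n, ∃ᶠ z in 𝓝[<] (q + -d), z ∈ Z n ∧ f z = z + d := fun n =>
      htend.frequently ((hd n).mono fun y hy => by simpa [sub_eq_add_neg] using hy)
    refine ⟨q + -d, mem_iInter.2 fun n => mem_closure_iff_frequently.2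
      (((hfr n).mono fun z hz => hz.1).filter_mono nhdsWithin_le_nhds), ?_⟩
    simp only [g]
    rw [hc_eq _ d ((hfr 0).mono fun z hz => hz.2)]
    ring
  obtain ⟨p, hpE, k, hk, hper⟩ := exists_periodic_of_right_isolated hE hEne hgcont hsurj hiso
  obtain ⟨y, hy, hyZ⟩ := ((eventually_iterate_nhdsLT hg k p).and (hleft p hpE 0)).exists
  rw [hper, sub_self, add_zero] at hy
  exact hyZ.2 (mem_attractor_of_periodic hI hk (hZI 0 hyZ) hy)

end IsPiecewiseTranslation

end attractor
/-- `K` is a finite union of preconnected sets. -/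
def HasFiniteConnectedCover (K : Set ℝ) : Prop :=
  ∃ 𝒞 : Set (Set ℝ), 𝒞.Finite ∧ (∀ C ∈ 𝒞, IsPreconnected C) ∧ K = ⋃₀ 𝒞

namespace HasFiniteConnectedCover

variable {K L : Set ℝ}

lemma of_homeomorph (hK : HasFiniteConnectedCover K) (h : K ≃ₜ L) : HasFiniteConnectedCover L := by
  obtain ⟨𝒞, hfin, hconn, hKe⟩ := hK
  refine ⟨(fun C => ((↑) : L → ℝ) '' (h '' ((↑) ⁻¹' C))) '' 𝒞, hfin.image _, ?_, ?_⟩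
  · rintro _ ⟨C, hC, rfl⟩
    have hCK : C ⊆ K := hKe ▸ subset_sUnion_of_mem hC
    have hpre : IsPreconnected (((↑) : K → ℝ) ⁻¹' C) := by
      rw [← Topology.IsInducing.subtypeVal.isPreconnected_image, Subtype.image_preimage_coe,
        inter_eq_right.2 hCK]
      exact hconn C hC
    exact (hpre.image h h.continuous.continuousOn).image _ continuous_subtype_val.continuousOn
  · ext y
    constructor
    · intro hy
      have hmem : ((h.symm ⟨y, hy⟩ : K) : ℝ) ∈ ⋃₀ 𝒞 := hKe ▸ (h.symm ⟨y, hy⟩).2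
      obtain ⟨C, hC, hyC⟩ := hmem
      exact ⟨_, ⟨C, hC, rfl⟩, ⟨y, hy⟩, ⟨_, hyC, h.apply_symm_apply _⟩, rfl⟩
    · rintro ⟨_, ⟨C, -, rfl⟩, z, -, rfl⟩
      exact z.2

lemma eventuallyDecided_nhdsGT (hK : HasFiniteConnectedCover K) (x : ℝ) :
    EventuallyDecided (𝓝[>] x) K := by
  obtain ⟨𝒞, hfin, hconn, rfl⟩ := hK
  rw [sUnion_eq_biUnion]
  exact .biUnion hfin fun C hC => (hconn C hC).ordConnected.eventuallyDecided_nhdsGT x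

lemma eventuallyDecided_nhdsLT (hK : HasFiniteConnectedCover K) (x : ℝ) :
    EventuallyDecided (𝓝[<] x) K := by
  obtain ⟨𝒞, hfin, hconn, rfl⟩ := hK
  rw [sUnion_eq_biUnion]
  exact .biUnion hfin fun C hC => (hconn C hC).ordConnected.eventuallyDecided_nhdsLT x

end HasFiniteConnectedCover

/-- If `f` translates each cell of the grid of mesh `1 / q` in `[0, 1)` by a multiple of `1 / q`,
then the closure of its attractor is a finite union of preconnected sets. -/
lemma hasFiniteConnectedCover_closure_attractor {f : ℝ → ℝ} {q : ℕ} (hq : 0 < q)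
    (hgrid : ∀ x ∈ Ico (0 : ℝ) 1, ∃ m : ℤ, ∀ y : ℝ, ⌊q * y⌋ = ⌊q * x⌋ → f y = y + m / q)
    (hI : MapsTo f (Ico 0 1) (Ico 0 1)) : HasFiniteConnectedCover (closure (attractor f)) := by
  have hq0 : (0 : ℝ) < q := Nat.cast_pos.2 hq
  have hcell : ∀ x : ℝ, x ∈ Ico (0 : ℝ) 1 ↔ ⌊q * x⌋ ∈ Ico (0 : ℤ) q := by
    intro x
    rw [mem_Ico, mem_Ico, Int.le_floor, Int.floor_lt, Int.cast_zero, Int.cast_natCast,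
      mul_nonneg_iff_of_pos_left hq0, mul_lt_iff_lt_one_right hq0]
  have hiter : ∀ n, ∀ x ∈ iterImage f n, ∀ y : ℝ, ⌊q * y⌋ = ⌊q * x⌋ → y ∈ iterImage f n := by
    intro n
    induction n with
    | zero =>
      intro x hx y hxy
      rw [iterImage_zero, hcell] at hx ⊢
      rwa [hxy]
    | succ n ih =>
      intro x hx y hxy
      have hn : iterImage f n ⊆ Ico 0 1 :=
        (iterImage_antitone hI n.zero_le).trans (iterImage_zero f).subset
      rw [iterImage_succ] at hx ⊢
      obtain ⟨z, hz, rfl⟩ := hx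
      obtain ⟨m, hm⟩ := hgrid z (hn hz)
      have hfloor : ⌊q * (y - m / q)⌋ = ⌊q * z⌋ := by
        rw [hm z rfl] at hxy
        have h1 : (q : ℝ) * (z + m / q) = q * z + m := by field_simp
        have h2 : (q : ℝ) * (y - m / q) = q * y - m := by field_simp
        rw [h1, Int.floor_add_intCast] at hxy
        rw [h2, Int.floor_sub_intCast, hxy, add_sub_cancel_right]
      exact ⟨y - m / q, ih z hz _ hfloor, by rw [hm _ hfloor]; ring⟩
  let S : Set ℤ := (fun x : ℝ => ⌊q * x⌋) '' attractor f
  have hS : S.Finite := (finite_Ico (0 : ℤ) q).subset (by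
    rintro _ ⟨x, hx, rfl⟩
    exact (hcell x).1 (iterImage_zero f ▸ attractor_subset f 0 hx))
  have hunion : attractor f = ⋃ k ∈ S, (fun x : ℝ => ⌊q * x⌋) ⁻¹' {k} := by
    ext x
    simp only [mem_iUnion]
    constructor
    · exact fun hx => ⟨_, ⟨x, hx, rfl⟩, rfl⟩
    · rintro ⟨_, ⟨z, hz, rfl⟩, hx⟩
      exact mem_iInter.2 fun n => hiter n z (attractor_subset f n hz) x hx
  have hmono : Monotone fun x : ℝ => ⌊q * x⌋ := fun x y h =>
    Int.floor_mono (mul_le_mul_of_nonneg_left h hq0.le)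
  refine ⟨(fun k => closure ((fun x : ℝ => ⌊q * x⌋) ⁻¹' {k})) '' S, hS.image _, ?_, ?_⟩
  · rintro _ ⟨k, -, rfl⟩
    exact (ordConnected_singleton.preimage_mono hmono).isPreconnected.closure
  · rw [hunion, hS.closure_biUnion, sUnion_image]

namespace ITM

variable {r : ℕ}

lemma exists_mem_Ico (T : ITM r) {x : ℝ} (hx : x ∈ Ico (0 : ℝ) 1) :
    ∃ i : Fin r, x ∈ Ico (T.beta i.castSucc) (T.beta i.succ) := by
  have key : ∀ j : Fin (r + 1), x < T.beta j →
      ∃ i : Fin r, x ∈ Ico (T.beta i.castSucc) (T.beta i.succ) := by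
    intro j
    induction j using Fin.induction with
    | zero => exact fun h => absurd hx.1 (not_le.2 (T.beta_zero ▸ h))
    | succ i ih =>
      intro h
      by_cases h' : x < T.beta i.castSucc
      · exact ih h'
      · exact ⟨i, not_lt.1 h', h⟩
  exact key (Fin.last r) (T.beta_last.symm ▸ hx.2)

lemma exists_mem_Ioc (T : ITM r) {x : ℝ} (hx : x ∈ Ioc (0 : ℝ) 1) :
    ∃ i : Fin r, x ∈ Ioc (T.beta i.castSucc) (T.beta i.succ) := by
  have key : ∀ j : Fin (r + 1), x ≤ T.beta j →
      ∃ i : Fin r, x ∈ Ioc (T.beta i.castSucc) (T.beta i.succ) := by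
    intro j
    induction j using Fin.induction with
    | zero => exact fun h => absurd hx.1 (not_lt.2 (T.beta_zero ▸ h))
    | succ i ih =>
      intro h
      by_cases h' : x ≤ T.beta i.castSucc
      · exact ih h'
      · exact ⟨i, not_le.1 h', h⟩
  exact key (Fin.last r) (T.beta_last.symm ▸ hx.2)

lemma beta_nonneg (T : ITM r) (j : Fin (r + 1)) : 0 ≤ T.beta j :=
  T.beta_zero ▸ T.beta_mono.monotone (Fin.zero_le j)

lemma beta_le_one (T : ITM r) (j : Fin (r + 1)) : T.beta j ≤ 1 :=
  T.beta_last ▸ T.beta_mono.monotone (Fin.le_last j)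

lemma f_eq_of_mem_Ico (T : ITM r) {x : ℝ} {i : Fin r}
    (hx : x ∈ Ico (T.beta i.castSucc) (T.beta i.succ)) : T.f x = x + T.gamma i := by
  have hI : x ∈ unitIco := ⟨(T.beta_nonneg _).trans hx.1, hx.2.trans_le (T.beta_le_one _)⟩
  have hex : ∃ i : Fin r, x ∈ Ico (T.beta i.castSucc) (T.beta i.succ) := ⟨i, hx⟩
  have hidx : T.idx x = i := by
    rw [idx, dif_pos hex]
    have hj := hex.choose_spec
    have h1 := T.beta_mono.lt_iff_lt.1 (hj.1.trans_lt hx.2)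
    have h2 := T.beta_mono.lt_iff_lt.1 (hx.1.trans_lt hj.2)
    rw [Fin.castSucc_lt_succ_iff] at h1 h2
    exact le_antisymm h1 h2
  rw [f, if_pos hI, hidx]

lemma f_eq_self (T : ITM r) {x : ℝ} (hx : x ∉ Ico (0 : ℝ) 1) : T.f x = x := if_neg hx

lemma mapsTo_f (T : ITM r) : MapsTo T.f (Ico 0 1) (Ico 0 1) := by
  intro x hx
  obtain ⟨i, hi⟩ := T.exists_mem_Ico hx
  have hγ := T.gamma_mem i
  rw [T.f_eq_of_mem_Ico hi]
  exact ⟨by linarith [hi.1, hγ.1], by linarith [hi.2, hγ.2]⟩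

lemma isPiecewiseTranslation_f (T : ITM r) : IsPiecewiseTranslation T.f where
  right x := by
    by_cases hx : x ∈ Ico (0 : ℝ) 1
    · obtain ⟨i, hi⟩ := T.exists_mem_Ico hx
      filter_upwards [Ico_mem_nhdsGE hi.2] with y hy
      rw [T.f_eq_of_mem_Ico hi, T.f_eq_of_mem_Ico ⟨hi.1.trans hy.1, hy.2⟩]
      ring
    · have hev := ((isTame_Ico 0 1 x).1.resolve_left
        fun h => hx (h.self_of_nhdsWithin self_mem_Ici))
      filter_upwards [hev] with y hy
      rw [T.f_eq_self hx, T.f_eq_self hy]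
      ring
  left x := by
    by_cases hx : x ∈ Ioc (0 : ℝ) 1
    · obtain ⟨i, hi⟩ := T.exists_mem_Ioc hx
      refine ⟨T.gamma i, ?_⟩
      filter_upwards [Ioo_mem_nhdsLT hi.1] with y hy
      exact T.f_eq_of_mem_Ico ⟨hy.1.le, hy.2.trans_le hi.2⟩
    · have hev : ∀ᶠ y in 𝓝[<] x, y ∉ Ico (0 : ℝ) 1 := by
        rcases le_or_gt x 0 with h | h
        · filter_upwards [self_mem_nhdsWithin] with y hy hyI
          exact absurd (hy.trans_le h) (not_lt.2 hyI.1)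
        · have h1 : 1 < x := not_le.1 fun h' => hx ⟨h, h'⟩
          filter_upwards [Ioo_mem_nhdsLT h1] with y hy hyI using absurd hy.1 (not_lt.2 hyI.2.le)
      exact ⟨0, by filter_upwards [hev] with y hy; rw [T.f_eq_self hy, add_zero]⟩
  finite := by
    refine ((finite_range T.gamma).insert 0).subset ?_
    rintro _ ⟨x, rfl⟩
    by_cases hx : x ∈ Ico (0 : ℝ) 1
    · obtain ⟨i, hi⟩ := T.exists_mem_Ico hx
      exact Or.inr ⟨i, by simp [T.f_eq_of_mem_Ico hi]⟩
    · exact Or.inl (by simp [T.f_eq_self hx])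

lemma Xbar_eq_closure_attractor (T : ITM r) : T.Xbar = closure (attractor T.f) := rfl

/-- Maps whose parameters are multiples of `1 / q` for some `q` are dense in `ITM(r)`. -/
lemma exists_grid_approx (T : ITM r) {δ : ℝ} (hδ : 0 < δ) :
    ∃ (S : ITM r) (q : ℕ) (B : Fin (r + 1) → ℤ) (G : Fin r → ℤ), pdist S T < δ ∧ 0 < q ∧
      (∀ j, S.beta j = B j / q) ∧ ∀ i, S.gamma i = G i / q := by
  have hgap : ∀ᶠ q : ℕ in atTop, ∀ i : Fin r,
      1 ≤ (q : ℝ) * (T.beta i.succ - T.beta i.castSucc) :=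
    eventually_all.2 fun i => (tendsto_natCast_atTop_atTop.atTop_mul_const
      (sub_pos.2 (T.beta_mono i.castSucc_lt_succ))).eventually_ge_atTop 1
  have hmesh : ∀ᶠ q : ℕ in atTop, 1 < (q : ℝ) * δ :=
    (tendsto_natCast_atTop_atTop.atTop_mul_const hδ).eventually_gt_atTop 1
  obtain ⟨q, hgap, hmesh, hq⟩ := (hgap.and (hmesh.and (eventually_gt_atTop 0))).exists
  have hq0 : (0 : ℝ) < q := Nat.cast_pos.2 hq
  let B : Fin (r + 1) → ℤ := fun j => ⌊q * T.beta j⌋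
  let G : Fin r → ℤ := fun i =>
    max (-B i.castSucc) (min ⌊q * T.gamma i⌋ (q - B i.succ))
  have hBle : ∀ j, (B j : ℝ) ≤ q * T.beta j := fun j => Int.floor_le _
  have hBlt : ∀ j, q * T.beta j < B j + 1 := fun j => Int.lt_floor_add_one _
  have hB0 : B 0 = 0 := by simp [B, T.beta_zero]
  have hB1 : B (Fin.last r) = q := by simp [B, T.beta_last]
  have hBmono : StrictMono B := by
    refine Fin.strictMono_iff_lt_succ.2 fun i => Int.lt_iff_add_one_le.2 (Int.le_floor.2 ?_)
    push_cast
    linarith [hgap i, hBle i.castSucc]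
  have hGmem : ∀ i, G i ∈ Icc (-B i.castSucc) (q - B i.succ) := by
    intro i
    refine ⟨le_max_left _ _, max_le ?_ (min_le_right _ _)⟩
    have h0 : B 0 ≤ B i.castSucc := hBmono.monotone (Fin.zero_le _)
    have h1 : B i.succ ≤ B (Fin.last r) := hBmono.monotone (Fin.le_last _)
    omega
  have hGabs : ∀ i, |(G i : ℝ) - q * T.gamma i| ≤ 1 := by
    intro i
    have hγ := T.gamma_mem i
    have hlo : q * -T.beta i.castSucc ≤ q * T.gamma i := mul_le_mul_of_nonneg_left hγ.1 hq0.le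
    have hhi : q * T.gamma i ≤ q * (1 - T.beta i.succ) := mul_le_mul_of_nonneg_left hγ.2 hq0.le
    have hfl := Int.floor_le (q * T.gamma i)
    have hfl' := Int.lt_floor_add_one (q * T.gamma i)
    simp only [G]
    push_cast
    refine abs_sub_le_iff.2 ⟨?_, ?_⟩
    · rw [sub_le_iff_le_add]
      refine max_le ?_ ((min_le_left _ _).trans ?_)
      · linarith [hBlt i.castSucc]
      · linarith
    · rw [sub_le_comm]
      refine le_max_of_le_right (le_min ?_ ?_)
      · linarith
      · linarith [hBle i.succ]
  have hdiv : ∀ (a b : ℝ), |a - q * b| ≤ 1 → dist (a / q) b < δ := by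
    intro a b h
    have : a / q - b = (a - q * b) / q := by field_simp
    rw [Real.dist_eq, this, abs_div, abs_of_pos hq0, div_lt_iff₀ hq0]
    linarith
  refine ⟨{ beta := fun j => B j / q
            gamma := fun i => G i / q
            two_le_r := T.two_le_r
            beta_zero := by simp [hB0]
            beta_last := by simp [hB1, hq0.ne']
            beta_mono := fun i j hij =>
              div_lt_div_of_pos_right (Int.cast_lt.2 (hBmono hij)) hq0
            gamma_mem := fun i => ?_ }, q, B, G, ?_, hq, fun _ => rfl, fun _ => rfl⟩
  · have h1 : (-B i.castSucc : ℝ) ≤ G i := by exact_mod_cast (hGmem i).1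
    have h2 : (G i : ℝ) ≤ q - B i.succ := by exact_mod_cast (hGmem i).2
    rw [mem_Icc, ← neg_div, one_sub_div hq0.ne']
    exact ⟨div_le_div_of_nonneg_right h1 hq0.le, div_le_div_of_nonneg_right h2 hq0.le⟩
  · refine max_lt ((dist_pi_lt_iff hδ).2 fun i => hdiv _ _ (hGabs i))
      ((dist_pi_lt_iff hδ).2 fun j => hdiv _ _ (abs_sub_le_iff.2 ⟨?_, ?_⟩))
    · linarith [hBle j]
    · linarith [hBlt j]

lemma hasFiniteConnectedCover_Xbar_of_grid (S : ITM r) {q : ℕ} (hq : 0 < q)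
    {B : Fin (r + 1) → ℤ} {G : Fin r → ℤ} (hB : ∀ j, S.beta j = B j / q)
    (hG : ∀ i, S.gamma i = G i / q) : HasFiniteConnectedCover S.Xbar := by
  rw [Xbar_eq_closure_attractor]
  refine hasFiniteConnectedCover_closure_attractor hq (fun x hx => ?_) S.mapsTo_f
  have hq0 : (0 : ℝ) < q := Nat.cast_pos.2 hq
  have hcell : ∀ (y : ℝ) (i : Fin r), y ∈ Ico (S.beta i.castSucc) (S.beta i.succ) ↔
      ⌊q * y⌋ ∈ Ico (B i.castSucc) (B i.succ) := by
    intro y i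
    rw [hB, hB, mem_Ico, mem_Ico, Int.le_floor, Int.floor_lt, div_le_iff₀' hq0, lt_div_iff₀' hq0]
  obtain ⟨i, hi⟩ := S.exists_mem_Ico hx
  refine ⟨G i, fun y hy => ?_⟩
  rw [S.f_eq_of_mem_Ico ((hcell y i).2 (hy ▸ (hcell x i).1 hi)), hG]

end ITM

/-- Every stable interval translation map is of finite type. -/
theorem finiteType_of_stable {r : ℕ} (T : ITM r) (hstab : T.Stable) :
    T.FiniteType := by
  obtain ⟨δ, hδ, hhomeo, -, -⟩ := hstab
  obtain ⟨S, q, B, G, hST, hq, hB, hG⟩ := T.exists_grid_approx hδ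
  obtain ⟨h⟩ := hhomeo S hST
  have hcover : HasFiniteConnectedCover (closure (attractor T.f)) :=
    (S.hasFiniteConnectedCover_Xbar_of_grid hq hB hG).of_homeomorph h
  have hf := T.isPiecewiseTranslation_f
  obtain ⟨n, hn⟩ := hf.exists_iterImage_eq_attractor T.mapsTo_f
    (hf.isTame_attractor T.mapsTo_f hcover.eventuallyDecided_nhdsGT
      hcover.eventuallyDecided_nhdsLT)
  refine ⟨n, (iterImage_antitone T.mapsTo_f n.le_succ).antisymm ?_⟩
  rw [hn]
  exact attractor_subset T.f (n + 1)
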